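/- arXiv:0806.3310 — 3 statements merged into one kernel-verified Lean document; each statement's English description precedes it below -/
import Mathlib

section
/- Let Ω ⊆ ℍ be a bounded open set, let f : ℍ → ℍ be continuously differentiable on Ω, and let h : ℍ → ℍ be continuous on Ω. If f is a weak solution on Ω of the inhomogeneous equation D_l f = h, i.e. ∫_Ω ( (D_r φ)(q)·f(q) + φ(q)·h(q) ) dV(q) = 0 for every test function φ on Ω, then f is a classical solution: (D_l f)(q) = h(q) at every point q ∈ Ω. -/
open MeasureTheory Metric Filter
open scoped Quaternion Topology

noncomputable section

/-- Borel measurable structure on the quaternions `ℍ ≅ ℝ⁴`. -/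
instance : MeasurableSpace ℍ[ℝ] := borel _
instance : BorelSpace ℍ[ℝ] := ⟨rfl⟩

/-- Lebesgue measure on `ℍ ≅ ℝ⁴`, i.e. the Haar measure normalized so that the unit cube
of an orthonormal basis has volume one. -/
instance : MeasureSpace ℍ[ℝ] := ⟨(stdOrthonormalBasis ℝ ℍ[ℝ]).toBasis.addHaar⟩

/-- The imaginary unit `i` of `ℍ`. -/
def qI : ℍ[ℝ] := ⟨0, 1, 0, 0⟩
/-- The imaginary unit `j` of `ℍ`. -/
def qJ : ℍ[ℝ] := ⟨0, 0, 1, 0⟩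
/-- The imaginary unit `k` of `ℍ`. -/
def qK : ℍ[ℝ] := ⟨0, 0, 0, 1⟩

/-- The left Fueter operator `D_l f = ∂f/∂t + i·∂f/∂x + j·∂f/∂y + k·∂f/∂z`. -/
def Dl (f : ℍ[ℝ] → ℍ[ℝ]) (q : ℍ[ℝ]) : ℍ[ℝ] :=
  fderiv ℝ f q 1 + qI * fderiv ℝ f q qI + qJ * fderiv ℝ f q qJ + qK * fderiv ℝ f q qK

/-- The right Fueter operator `D_r f = ∂f/∂t + (∂f/∂x)·i + (∂f/∂y)·j + (∂f/∂z)·k`. -/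
def Dr (f : ℍ[ℝ] → ℍ[ℝ]) (q : ℍ[ℝ]) : ℍ[ℝ] :=
  fderiv ℝ f q 1 + fderiv ℝ f q qI * qI + fderiv ℝ f q qJ * qJ + fderiv ℝ f q qK * qK

/-- The Cauchy–Fueter kernel `E(q,p) = (1/(2π²))·(q−p)⁻¹/|q−p|²`. -/
def E (q p : ℍ[ℝ]) : ℍ[ℝ] := ((2 * Real.pi ^ 2)⁻¹ * (‖q - p‖ ^ 2)⁻¹) • (q - p)⁻¹

/-- A test function on a bounded open set `Ω ⊆ ℍ`: a smooth function with compact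
support contained in `Ω`. -/
structure IsTestFunction (φ : ℍ[ℝ] → ℍ[ℝ]) (Ω : Set ℍ[ℝ]) : Prop where
  smooth : ContDiff ℝ (⊤ : ℕ∞) φ
  compact_supp : HasCompactSupport φ
  supp_subset : tsupport φ ⊆ Ω

instance : (volume : Measure ℍ[ℝ]).IsAddHaarMeasure :=
  inferInstanceAs (stdOrthonormalBasis ℝ ℍ[ℝ]).toBasis.addHaar.IsAddHaarMeasure

/-- The product of a continuous function compactly supported in `Ω` with a function continuous
on `Ω` is integrable. -/
lemma integrable_mul_of_tsupport_subset {Ω : Set ℍ[ℝ]} {φ u : ℍ[ℝ] → ℍ[ℝ]}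
    (hφ : Continuous φ) (hc : HasCompactSupport φ) (hs : tsupport φ ⊆ Ω)
    (hu : ContinuousOn u Ω) : Integrable (fun q ↦ φ q * u q) := by
  rw [← integrableOn_iff_integrable_of_support_subset (s := tsupport φ)]
  · exact (hφ.continuousOn.mul (hu.mono hs)).integrableOn_compact hc
  · intro q hq
    refine subset_tsupport φ fun h0 ↦ hq ?_
    simp [h0]

lemma IsTestFunction.integrable_mul {Ω : Set ℍ[ℝ]} {φ u : ℍ[ℝ] → ℍ[ℝ]}
    (hφ : IsTestFunction φ Ω) (hu : ContinuousOn u Ω) : Integrable (fun q ↦ φ q * u q) :=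
  integrable_mul_of_tsupport_subset hφ.smooth.continuous hφ.compact_supp hφ.supp_subset hu

lemma IsTestFunction.integrable_fderiv_mul_mul {Ω : Set ℍ[ℝ]} {φ u : ℍ[ℝ] → ℍ[ℝ]}
    (hφ : IsTestFunction φ Ω) (hu : ContinuousOn u Ω) (v e : ℍ[ℝ]) :
    Integrable (fun q ↦ fderiv ℝ φ q v * e * u q) := by
  simp_rw [mul_assoc]
  have hcont : Continuous (fderiv ℝ φ) := hφ.smooth.continuous_fderiv (by simp)
  exact integrable_mul_of_tsupport_subset (φ := fun q ↦ fderiv ℝ φ q v)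
    (hcont.clm_apply continuous_const) (hφ.compact_supp.fderiv_apply ℝ v)
    ((tsupport_fderiv_apply_subset ℝ v).trans hφ.supp_subset) (continuousOn_const.mul hu)

lemma continuousOn_fderiv_apply {Ω : Set ℍ[ℝ]} (hΩ : IsOpen Ω) {f : ℍ[ℝ] → ℍ[ℝ]}
    (hf : ContDiffOn ℝ 1 f Ω) (v : ℍ[ℝ]) : ContinuousOn (fun q ↦ fderiv ℝ f q v) Ω :=
  (hf.continuousOn_fderiv_of_isOpen hΩ le_rfl).clm_apply continuousOn_const

lemma continuousOn_Dl {Ω : Set ℍ[ℝ]} (hΩ : IsOpen Ω) {f : ℍ[ℝ] → ℍ[ℝ]}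
    (hf : ContDiffOn ℝ 1 f Ω) : ContinuousOn (Dl f) Ω := by
  have h := continuousOn_fderiv_apply hΩ hf
  exact (((h 1).add (continuousOn_const.mul (h qI))).add
    (continuousOn_const.mul (h qJ))).add (continuousOn_const.mul (h qK))

/-- Integration by parts in the direction `v`, with a constant factor `e` in the middle. -/
lemma IsTestFunction.integral_fderiv_mul_mul {Ω : Set ℍ[ℝ]} (hΩ : IsOpen Ω)
    {φ f : ℍ[ℝ] → ℍ[ℝ]} (hφ : IsTestFunction φ Ω) (hf : ContDiffOn ℝ 1 f Ω) (v e : ℍ[ℝ]) :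
    ∫ q, fderiv ℝ φ q v * e * f q = -∫ q, φ q * (e * fderiv ℝ f q v) := by
  have key := integral_bilinear_fderiv_right_eq_neg_left_of_integrable
    (μ := (volume : Measure ℍ[ℝ])) (f := φ) (g := f) (v := v)
    (B := (ContinuousLinearMap.mul ℝ ℍ[ℝ]).comp ((ContinuousLinearMap.mul ℝ ℍ[ℝ]).flip e))
    (by simpa using hφ.integrable_fderiv_mul_mul hf.continuousOn v e)
    (by simpa [mul_assoc] using
      hφ.integrable_mul (continuousOn_const.mul (continuousOn_fderiv_apply hΩ hf v)))
    (by simpa [mul_assoc] using hφ.integrable_mul (continuousOn_const.mul hf.continuousOn))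
    (fun q _ ↦ hφ.smooth.differentiable (by simp) q)
    (fun q hq ↦ (hf.differentiableOn one_ne_zero).differentiableAt
      (hΩ.mem_nhds (hφ.supp_subset hq)))
  simp only [ContinuousLinearMap.comp_apply, ContinuousLinearMap.flip_apply,
    ContinuousLinearMap.mul_apply', mul_assoc] at key
  simp only [mul_assoc, key, neg_neg]

lemma Dr_mul_eq_sum (φ u : ℍ[ℝ] → ℍ[ℝ]) : (fun q ↦ Dr φ q * u q) =
    (fun q ↦ fderiv ℝ φ q 1 * 1 * u q) + (fun q ↦ fderiv ℝ φ q qI * qI * u q)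
      + (fun q ↦ fderiv ℝ φ q qJ * qJ * u q) + (fun q ↦ fderiv ℝ φ q qK * qK * u q) := by
  funext q
  simp only [Dr, add_mul, mul_one, Pi.add_apply]

lemma mul_Dl_eq_sum (φ f : ℍ[ℝ] → ℍ[ℝ]) : (fun q ↦ φ q * Dl f q) =
    (fun q ↦ φ q * (1 * fderiv ℝ f q 1)) + (fun q ↦ φ q * (qI * fderiv ℝ f q qI))
      + (fun q ↦ φ q * (qJ * fderiv ℝ f q qJ)) + (fun q ↦ φ q * (qK * fderiv ℝ f q qK)) := by
  funext q
  simp only [Dl, mul_add, one_mul, Pi.add_apply]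

lemma IsTestFunction.integrable_Dr_mul {Ω : Set ℍ[ℝ]} {φ u : ℍ[ℝ] → ℍ[ℝ]}
    (hφ : IsTestFunction φ Ω) (hu : ContinuousOn u Ω) : Integrable (fun q ↦ Dr φ q * u q) := by
  have h := hφ.integrable_fderiv_mul_mul hu
  rw [Dr_mul_eq_sum]
  exact (((h 1 1).add (h qI qI)).add (h qJ qJ)).add (h qK qK)

/-- The Fueter operators `Dr` and `-Dl` are formally adjoint. -/
lemma IsTestFunction.integral_Dr_mul {Ω : Set ℍ[ℝ]} (hΩ : IsOpen Ω)
    {φ f : ℍ[ℝ] → ℍ[ℝ]} (hφ : IsTestFunction φ Ω) (hf : ContDiffOn ℝ 1 f Ω) :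
    ∫ q, Dr φ q * f q = -∫ q, φ q * Dl f q := by
  have h := hφ.integrable_fderiv_mul_mul hf.continuousOn
  have h' (v e : ℍ[ℝ]) : Integrable (fun q ↦ φ q * (e * fderiv ℝ f q v)) :=
    hφ.integrable_mul (continuousOn_const.mul (continuousOn_fderiv_apply hΩ hf v))
  rw [Dr_mul_eq_sum, mul_Dl_eq_sum,
    integral_add' (((h 1 1).add (h qI qI)).add (h qJ qJ)) (h qK qK),
    integral_add' ((h 1 1).add (h qI qI)) (h qJ qJ), integral_add' (h 1 1) (h qI qI),
    integral_add' (((h' 1 1).add (h' qI qI)).add (h' qJ qJ)) (h' qK qK),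
    integral_add' ((h' 1 1).add (h' qI qI)) (h' qJ qJ), integral_add' (h' 1 1) (h' qI qI)]
  simp only [hφ.integral_fderiv_mul_mul hΩ hf]
  abel

lemma IsTestFunction.ofReal_smul_one {Ω : Set ℍ[ℝ]} {g : ℍ[ℝ] → ℝ}
    (hg : ContDiff ℝ (⊤ : ℕ∞) g) (hc : HasCompactSupport g) (hs : tsupport g ⊆ Ω) :
    IsTestFunction (fun q ↦ g q • (1 : ℍ[ℝ])) Ω where
  smooth := hg.smul contDiff_const
  compact_supp := hc.smul_right
  supp_subset := (closure_mono (Function.support_smul_subset_left g _)).trans hs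

/-- **Weak `C¹` solutions of the inhomogeneous Fueter equation are classical solutions.**
If `∫_Ω ((D_r φ)·f + φ·h) dV = 0` for every test function `φ` on `Ω`, then `D_l f = h`
on `Ω`. -/
theorem weak_solution_is_classical (Ω : Set ℍ[ℝ]) (hΩ : IsOpen Ω)
    (hΩb : Bornology.IsBounded Ω) (f h : ℍ[ℝ] → ℍ[ℝ])
    (hf : ContDiffOn ℝ 1 f Ω) (hh : ContinuousOn h Ω)
    (hweak : ∀ φ : ℍ[ℝ] → ℍ[ℝ], IsTestFunction φ Ω →
      ∫ q in Ω, (Dr φ q * f q + φ q * h q) = 0) :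
    ∀ q ∈ Ω, Dl f q = h q := by
  have hcont : ContinuousOn (fun q ↦ h q - Dl f q) Ω := hh.sub (continuousOn_Dl hΩ hf)
  have hae : ∀ᵐ q, q ∈ Ω → h q - Dl f q = 0 := by
    refine hΩ.ae_eq_zero_of_integral_contDiff_smul_eq_zero
      (hcont.locallyIntegrableOn hΩ.measurableSet) fun g hg hc hs ↦ ?_
    have hφ := IsTestFunction.ofReal_smul_one hg hc hs
    have hw := hweak _ hφ
    set φ : ℍ[ℝ] → ℍ[ℝ] := fun q ↦ g q • (1 : ℍ[ℝ]) with hφdef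
    rw [setIntegral_eq_integral_of_forall_compl_eq_zero,
      integral_add (hφ.integrable_Dr_mul hf.continuousOn) (hφ.integrable_mul hh),
      hφ.integral_Dr_mul hΩ hf, neg_add_eq_sub,
      ← integral_sub (hφ.integrable_mul hh) (hφ.integrable_mul (continuousOn_Dl hΩ hf))] at hw
    · simpa [hφdef, smul_sub] using hw
    · intro q hq
      have hq' : q ∉ tsupport φ := fun hmem ↦ hq (hφ.supp_subset hmem)
      have h0 : fderiv ℝ φ q = 0 := fderiv_of_notMem_tsupport ℝ hq'
      have h1 : φ q = 0 := image_eq_zero_of_notMem_tsupport hq'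
      change Dr φ q * f q + φ q * h q = 0
      simp only [Dr, h0, h1, _root_.zero_apply, zero_mul, add_zero]
  have heq : Set.EqOn (fun q ↦ h q - Dl f q) (fun _ ↦ 0) Ω :=
    Measure.eqOn_open_of_ae_eq (μ := volume)
      ((ae_restrict_iff' hΩ.measurableSet).2 hae) hΩ hcont continuousOn_const
  exact fun q hq ↦ (sub_eq_zero.1 (heq hq)).symm
end
end

section
/- Let Ω ⊆ ℍ be a bounded open set and let h : ℍ → ℍ be bounded and measurable on Ω. Define g : ℍ → ℍ by g(p) := −∫_Ω E(q,p)·h(q) dV(q). Then g is a weak solution on Ω of the equation D_l g = h: for every test function φ on Ω, ∫_Ω ( (D_r φ)(q)·g(q) + φ(q)·h(q) ) dV(q) = 0. -/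
open MeasureTheory Metric Filter
open scoped Quaternion Topology

noncomputable section

/-- The regularization `p̄ / (|p|² + δ²)²` of the (unnormalized) Cauchy–Fueter kernel. -/
def regKernel (δ : ℝ) (p : ℍ[ℝ]) : ℍ[ℝ] := ((‖p‖ ^ 2 + δ ^ 2) ^ 2)⁻¹ • star p

instance inst_s8 : (volume : Measure ℍ[ℝ]).IsAddHaarMeasure :=
  inferInstanceAs ((stdOrthonormalBasis ℝ ℍ[ℝ]).toBasis.addHaar).IsAddHaarMeasure

lemma volume_real_unit_ball : (volume : Measure ℍ[ℝ]).real (ball 0 1) = Real.pi ^ 2 / 2 := by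
  have h := InnerProductSpace.volume_ball_of_dim_even (E := ℍ[ℝ]) (k := 2)
    (by rw [Quaternion.finrank_eq_four]) 0 1
  have h' : (volume : Measure ℍ[ℝ]) (ball 0 1) = ENNReal.ofReal (Real.pi ^ 2 / 2) := by
    simpa using h
  rw [Measure.real, h', ENNReal.toReal_ofReal (by positivity)]

lemma hasDerivAt_radial (r : ℝ) :
    HasDerivAt (fun r : ℝ => r ^ 4 / (4 * (r ^ 2 + 1) ^ 2)) (r ^ 3 * ((r ^ 2 + 1) ^ 3)⁻¹) r := by
  have h0 : r ^ 2 + 1 ≠ 0 := by positivity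
  have h1 := (hasDerivAt_pow 4 r).div
    ((((hasDerivAt_pow 2 r).add_const (1 : ℝ)).pow 2).const_mul 4)
    (mul_ne_zero four_ne_zero (pow_ne_zero 2 h0))
  refine h1.congr_deriv ?_
  simp
  field_simp
  ring

lemma tendsto_radial :
    Tendsto (fun r : ℝ => r ^ 4 / (4 * (r ^ 2 + 1) ^ 2)) atTop (𝓝 (1 / 4)) := by
  have h : Tendsto (fun r : ℝ => 1 / (4 * (1 + (r ^ 2)⁻¹) ^ 2)) atTop
      (𝓝 (1 / (4 * (1 + 0) ^ 2))) := by
    refine Tendsto.div tendsto_const_nhds ?_ (by norm_num)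
    refine (((tendsto_inv_atTop_zero.comp (tendsto_pow_atTop two_ne_zero)).const_add 1).pow
      2).const_mul 4
  norm_num at h
  norm_num
  refine h.congr' ?_
  filter_upwards [eventually_gt_atTop 0] with r hr
  field_simp

lemma integrable_bump : Integrable (fun u : ℍ[ℝ] => ((‖u‖ ^ 2 + 1) ^ 3)⁻¹) := by
  rw [integrable_fun_norm_addHaar volume (f := fun r : ℝ => ((r ^ 2 + 1) ^ 3)⁻¹)]
  simp only [Quaternion.finrank_eq_four, smul_eq_mul]
  exact integrableOn_Ioi_deriv_of_nonneg' (fun r _ => hasDerivAt_radial r)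
    (fun r hr => by have : (0 : ℝ) < r := hr; positivity) tendsto_radial

lemma integral_bump : ∫ u : ℍ[ℝ], ((‖u‖ ^ 2 + 1) ^ 3)⁻¹ = Real.pi ^ 2 / 2 := by
  rw [integral_fun_norm_addHaar volume (fun r : ℝ => ((r ^ 2 + 1) ^ 3)⁻¹)]
  simp only [Quaternion.finrank_eq_four, smul_eq_mul, volume_real_unit_ball]
  rw [integral_Ioi_of_hasDerivAt_of_nonneg' (fun r _ => hasDerivAt_radial r)
    (fun r hr => by have : (0 : ℝ) < r := hr; positivity) tendsto_radial]
  norm_num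
  ring

instance : StarModule ℝ ℍ[ℝ] := ⟨fun r q => by ext <;> simp⟩

lemma hasFDerivAt_regKernel {δ : ℝ} (hδ : 0 < δ) (p : ℍ[ℝ]) :
    HasFDerivAt (regKernel δ)
      (((‖p‖ ^ 2 + δ ^ 2) ^ 2)⁻¹ • ((starL' ℝ : ℍ[ℝ] ≃L[ℝ] ℍ[ℝ]) : ℍ[ℝ] →L[ℝ] ℍ[ℝ]) +
        ((-4 * ((‖p‖ ^ 2 + δ ^ 2) ^ 3)⁻¹) • innerSL ℝ p).smulRight (star p)) p := by
  have h0 : ‖p‖ ^ 2 + δ ^ 2 ≠ 0 := by positivity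
  have h1 : HasFDerivAt (fun p : ℍ[ℝ] => ((‖p‖ ^ 2 + δ ^ 2) ^ 2)⁻¹)
      ((-4 * ((‖p‖ ^ 2 + δ ^ 2) ^ 3)⁻¹) • innerSL ℝ p) p := by
    have h2 : HasDerivAt (fun s : ℝ => ((s + δ ^ 2) ^ 2)⁻¹) (-2 * ((‖p‖ ^ 2 + δ ^ 2) ^ 3)⁻¹)
        (‖p‖ ^ 2) := by
      refine ((((hasDerivAt_id _).add_const (δ ^ 2)).pow 2).inv (pow_ne_zero 2 h0)).congr_deriv ?_
      simp
      field_simp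
    refine (h2.comp_hasFDerivAt p (hasStrictFDerivAt_norm_sq p).hasFDerivAt).congr_fderiv ?_
    ext v
    simp
    ring
  exact h1.smul ((starL' ℝ : ℍ[ℝ] ≃L[ℝ] ℍ[ℝ]).hasFDerivAt)

lemma fderiv_regKernel_apply {δ : ℝ} (hδ : 0 < δ) (p v : ℍ[ℝ]) :
    fderiv ℝ (regKernel δ) p v = ((‖p‖ ^ 2 + δ ^ 2) ^ 2)⁻¹ • star v +
      (-4 * ((‖p‖ ^ 2 + δ ^ 2) ^ 3)⁻¹ * inner ℝ p v) • star p := by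
  rw [(hasFDerivAt_regKernel hδ p).fderiv]
  simp

lemma Dl_regKernel {δ : ℝ} (hδ : 0 < δ) (p : ℍ[ℝ]) :
    Dl (regKernel δ) p = ((4 * δ ^ 2 * ((‖p‖ ^ 2 + δ ^ 2) ^ 3)⁻¹ : ℝ) : ℍ[ℝ]) := by
  have h0 : ‖p‖ ^ 2 + δ ^ 2 ≠ 0 := by positivity
  have hn : ‖p‖ ^ 2 = p.re ^ 2 + p.imI ^ 2 + p.imJ ^ 2 + p.imK ^ 2 := by
    rw [pow_two ‖p‖, ← Quaternion.normSq_eq_norm_mul_self, Quaternion.normSq_def']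
  have h2 : ((‖p‖ ^ 2 + δ ^ 2) ^ 2)⁻¹ = (‖p‖ ^ 2 + δ ^ 2) * ((‖p‖ ^ 2 + δ ^ 2) ^ 3)⁻¹ := by
    field_simp
  have hi : qI.re = 0 ∧ qI.imI = 1 ∧ qI.imJ = 0 ∧ qI.imK = 0 := ⟨rfl, rfl, rfl, rfl⟩
  have hj : qJ.re = 0 ∧ qJ.imI = 0 ∧ qJ.imJ = 1 ∧ qJ.imK = 0 := ⟨rfl, rfl, rfl, rfl⟩
  have hk : qK.re = 0 ∧ qK.imI = 0 ∧ qK.imJ = 0 ∧ qK.imK = 1 := ⟨rfl, rfl, rfl, rfl⟩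
  simp only [Dl, fderiv_regKernel_apply hδ, h2]
  generalize ((‖p‖ ^ 2 + δ ^ 2) ^ 3)⁻¹ = c
  rw [hn]
  generalize δ ^ 2 = d
  ext <;> simp [hi, hj, hk, Quaternion.inner_def, -Quaternion.coe_mul] <;> ring

lemma contDiff_regKernel {δ : ℝ} (hδ : 0 < δ) : ContDiff ℝ 1 (regKernel δ) := by
  have h : ContDiff ℝ 1 fun p : ℍ[ℝ] => (‖p‖ ^ 2 + δ ^ 2) ^ 2 :=
    ((contDiff_norm_sq ℝ).add contDiff_const).pow 2
  exact (h.inv fun p => by positivity).smul (starL' ℝ : ℍ[ℝ] ≃L[ℝ] ℍ[ℝ]).contDiff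

lemma integral_add_add_add {f₁ f₂ f₃ f₄ : ℍ[ℝ] → ℍ[ℝ]} (h₁ : Integrable f₁) (h₂ : Integrable f₂)
    (h₃ : Integrable f₃) (h₄ : Integrable f₄) :
    ∫ x, (f₁ x + f₂ x + f₃ x + f₄ x) = (∫ x, f₁ x) + (∫ x, f₂ x) + (∫ x, f₃ x) + ∫ x, f₄ x := by
  calc
    _ = (∫ x, (f₁ + f₂ + f₃) x) + ∫ x, f₄ x := integral_add ((h₁.add h₂).add h₃) h₄
    _ = (∫ x, (f₁ + f₂) x) + (∫ x, f₃ x) + ∫ x, f₄ x := by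
      rw [← integral_add (h₁.add h₂) h₃]
      rfl
    _ = _ := by
      rw [← integral_add h₁ h₂]
      rfl

section IntegrationByParts

variable {f g : ℍ[ℝ] → ℍ[ℝ]} (hf : ContDiff ℝ 1 f) (hfc : HasCompactSupport f)
  (hg : ContDiff ℝ 1 g) (e : ℍ[ℝ])

lemma continuous_fderiv_apply (hf : ContDiff ℝ 1 f) (e : ℍ[ℝ]) :
    Continuous fun x => fderiv ℝ f x e :=
  (hf.continuous_fderiv one_ne_zero).clm_apply continuous_const

lemma hasCompactSupport_fderiv_apply (hfc : HasCompactSupport f) (e : ℍ[ℝ]) :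
    HasCompactSupport fun x => fderiv ℝ f x e :=
  hfc.fderiv_apply (𝕜 := ℝ) e

include hf hfc hg in
lemma integrable_fderiv_mul_mul : Integrable fun x => fderiv ℝ f x e * e * g x :=
  Continuous.integrable_of_hasCompactSupport
    (((continuous_fderiv_apply hf e).mul continuous_const).mul hg.continuous)
    ((hasCompactSupport_fderiv_apply hfc e).mul_right.mul_right)

include hf hfc hg in
lemma integrable_mul_mul_fderiv : Integrable fun x => f x * (e * fderiv ℝ g x e) :=
  Continuous.integrable_of_hasCompactSupport
    (hf.continuous.mul (continuous_const.mul (continuous_fderiv_apply hg e))) hfc.mul_right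

include hf hfc hg in
lemma integral_fderiv_mul_mul :
    ∫ x, fderiv ℝ f x e * e * g x = -∫ x, f x * (e * fderiv ℝ g x e) := by
  let B : ℍ[ℝ] →L[ℝ] ℍ[ℝ] →L[ℝ] ℍ[ℝ] :=
    (ContinuousLinearMap.mul ℝ ℍ[ℝ]).comp ((ContinuousLinearMap.mul ℝ ℍ[ℝ]).flip e)
  have hB : ∀ a b, B a b = a * e * b := fun a b => rfl
  have h := integral_bilinear_fderiv_right_eq_neg_left_of_integrable (μ := volume) (f := f)
    (g := g) (v := e) (B := B)
    (by simpa only [hB] using integrable_fderiv_mul_mul hf hfc hg e)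
    (by simpa only [hB, mul_assoc] using integrable_mul_mul_fderiv hf hfc hg e)
    (by
      simp only [hB]
      exact Continuous.integrable_of_hasCompactSupport
        ((hf.continuous.mul continuous_const).mul hg.continuous) hfc.mul_right.mul_right)
    (fun x _ => (hf.differentiable one_ne_zero) x) (fun x _ => (hg.differentiable one_ne_zero) x)
  simp only [hB] at h
  simp only [← mul_assoc, h, neg_neg]

include hf hfc hg in
lemma integral_Dr_mul : ∫ x, Dr f x * g x = -∫ x, f x * Dl g x := by
  have i1 := integrable_fderiv_mul_mul hf hfc hg
  have i2 := integrable_mul_mul_fderiv hf hfc hg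
  have e1 : ∀ x, Dr f x * g x = fderiv ℝ f x 1 * 1 * g x + fderiv ℝ f x qI * qI * g x +
      fderiv ℝ f x qJ * qJ * g x + fderiv ℝ f x qK * qK * g x := fun x => by
    simp only [Dr, add_mul, mul_one]
  have e2 : ∀ x, f x * Dl g x = f x * (1 * fderiv ℝ g x 1) + f x * (qI * fderiv ℝ g x qI) +
      f x * (qJ * fderiv ℝ g x qJ) + f x * (qK * fderiv ℝ g x qK) := fun x => by
    simp only [Dl, mul_add, one_mul]
  simp only [e1, e2]
  rw [integral_add_add_add (i1 1) (i1 qI) (i1 qJ) (i1 qK),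
    integral_add_add_add (i2 1) (i2 qI) (i2 qJ) (i2 qK)]
  simp only [integral_fderiv_mul_mul hf hfc hg]
  abel

end IntegrationByParts

lemma norm_regKernel (δ : ℝ) (p : ℍ[ℝ]) :
    ‖regKernel δ p‖ = ((‖p‖ ^ 2 + δ ^ 2) ^ 2)⁻¹ * ‖p‖ := by
  rw [regKernel, norm_smul, Quaternion.norm_star, Real.norm_of_nonneg (by positivity)]

lemma norm_regKernel_le (δ : ℝ) (p : ℍ[ℝ]) : ‖regKernel δ p‖ ≤ ‖regKernel 0 p‖ := by
  rcases eq_or_ne p 0 with rfl | hp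
  · simp [regKernel]
  · have : 0 < ‖p‖ := norm_pos_iff.2 hp
    rw [norm_regKernel, norm_regKernel]
    have hδ : ‖p‖ ^ 2 + 0 ^ 2 ≤ ‖p‖ ^ 2 + δ ^ 2 := by nlinarith [sq_nonneg δ]
    have h0 : 0 < ‖p‖ ^ 2 + (0 : ℝ) ^ 2 := by positivity
    gcongr

lemma measurable_regKernel (δ : ℝ) : Measurable (regKernel δ) := by
  have h1 : Continuous fun p : ℍ[ℝ] => (‖p‖ ^ 2 + δ ^ 2) ^ 2 := by fun_prop
  have h2 : Continuous fun p : ℍ[ℝ] => star p := continuous_star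
  exact h1.measurable.inv.smul h2.measurable

lemma locallyIntegrable_regKernel_zero : LocallyIntegrable (regKernel 0) := by
  refine locallyIntegrable_of_norm_le_rpow (C := 1) (α := 3) (by simp [Quaternion.finrank_eq_four])
    (by rw [Quaternion.finrank_eq_four]; norm_num) (Eventually.of_forall fun p => ?_)
    (measurable_regKernel 0).aestronglyMeasurable
  rcases eq_or_ne p 0 with rfl | hp
  · simp [regKernel]
  · have : 0 < ‖p‖ := norm_pos_iff.2 hp
    rw [norm_regKernel, Real.rpow_neg this.le]
    norm_cast
    refine le_of_eq ?_
    simp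
    field_simp

lemma E_eq_regKernel (q p : ℍ[ℝ]) : E q p = -((2 * Real.pi ^ 2)⁻¹ • regKernel 0 (p - q)) := by
  rw [E, regKernel, ← neg_sub p q, norm_neg, inv_neg, smul_neg,
    show (p - q)⁻¹ = (Quaternion.normSq (p - q))⁻¹ • star (p - q) from rfl]
  simp only [smul_smul, Quaternion.normSq_eq_norm_mul_self]
  congr 2
  ring

lemma continuous_Dr {φ : ℍ[ℝ] → ℍ[ℝ]} (hφ : ContDiff ℝ 1 φ) : Continuous (Dr φ) := by
  have := fun e => continuous_fderiv_apply hφ e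
  unfold Dr
  fun_prop

lemma tsupport_Dr_subset (φ : ℍ[ℝ] → ℍ[ℝ]) : tsupport (Dr φ) ⊆ tsupport φ := by
  refine closure_minimal (fun x hx => ?_) (isClosed_tsupport φ)
  by_contra h
  refine hx ?_
  have : fderiv ℝ φ x = 0 := by
    by_contra h'
    exact h (support_fderiv_subset ℝ h')
  simp [Dr, this]

lemma hasCompactSupport_Dr {φ : ℍ[ℝ] → ℍ[ℝ]} (hφ : HasCompactSupport φ) :
    HasCompactSupport (Dr φ) :=
  hφ.of_isClosed_subset (isClosed_tsupport _) (tsupport_Dr_subset φ)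

lemma integrable_mul_regKernel {ψ : ℍ[ℝ] → ℍ[ℝ]} (hψ : Continuous ψ)
    (hc : HasCompactSupport ψ) : Integrable fun p => ψ p * regKernel 0 p :=
  locallyIntegrable_regKernel_zero.integrable_smul_left_of_hasCompactSupport hψ hc

lemma integrable_mul_E {ψ : ℍ[ℝ] → ℍ[ℝ]} (hψ : Continuous ψ) (hc : HasCompactSupport ψ)
    (q : ℍ[ℝ]) : Integrable fun p => ψ p * E q p := by
  have h := ((integrable_mul_regKernel (ψ := fun x => ψ (x + q)) (by fun_prop)
    (hc.comp_homeomorph (Homeomorph.addRight q))).comp_sub_right q).const_mul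
      ((-(2 * Real.pi ^ 2)⁻¹ : ℝ) : ℍ[ℝ])
  refine h.congr (Eventually.of_forall fun p => ?_)
  simp only [sub_add_cancel, E_eq_regKernel, Quaternion.coe_mul_eq_smul, mul_neg, mul_smul_comm,
    neg_smul]

lemma tendsto_integral_mul_regKernel {ψ : ℍ[ℝ] → ℍ[ℝ]} (hψ : Continuous ψ)
    (hc : HasCompactSupport ψ) :
    Tendsto (fun δ => ∫ p, ψ p * regKernel δ p) (𝓝[>] 0) (𝓝 (∫ p, ψ p * regKernel 0 p)) := by
  refine tendsto_integral_filter_of_dominated_convergence (fun p => ‖ψ p * regKernel 0 p‖)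
    (Eventually.of_forall fun δ =>
      (hψ.measurable.mul (measurable_regKernel δ)).aestronglyMeasurable)
    (Eventually.of_forall fun δ => Eventually.of_forall fun p => ?_)
    (integrable_mul_regKernel hψ hc).norm (Eventually.of_forall fun p => ?_)
  · rw [norm_mul, norm_mul]
    gcongr
    exact norm_regKernel_le δ p
  · refine Tendsto.const_mul _ ?_
    rcases eq_or_ne p 0 with rfl | hp
    · simp [regKernel]
    · have h0 : (‖p‖ ^ 2 + 0 ^ 2) ^ 2 ≠ 0 := by
        have : 0 < ‖p‖ := norm_pos_iff.2 hp
        positivity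
      have h : ContinuousAt (fun δ : ℝ => (‖p‖ ^ 2 + δ ^ 2) ^ 2) 0 := by fun_prop
      exact ((h.inv₀ h0).smul continuousAt_const).tendsto.mono_left nhdsWithin_le_nhds

lemma integral_mul_Dl_regKernel (φ : ℍ[ℝ] → ℍ[ℝ]) {δ : ℝ} (hδ : 0 < δ) :
    ∫ p, φ p * Dl (regKernel δ) p = ∫ u, (4 * ((‖u‖ ^ 2 + 1) ^ 3)⁻¹) • φ (δ • u) := by
  have h := Measure.integral_comp_smul volume (fun p => φ p * Dl (regKernel δ) p) δ
  rw [Quaternion.finrank_eq_four, abs_of_pos (by positivity), eq_inv_smul_iff₀ (by positivity)] at h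
  rw [← h, ← integral_smul]
  refine integral_congr_ae (Eventually.of_forall fun u => ?_)
  simp only [Dl_regKernel hδ, Quaternion.mul_coe_eq_smul, smul_smul, norm_smul, Real.norm_eq_abs,
    mul_pow, sq_abs]
  congr 1
  have h1 : δ ^ 2 * ‖u‖ ^ 2 + δ ^ 2 = δ ^ 2 * (‖u‖ ^ 2 + 1) := by ring
  rw [h1]
  field_simp

lemma tendsto_integral_mul_Dl_regKernel {φ : ℍ[ℝ] → ℍ[ℝ]} (hφ : Continuous φ)
    (hc : HasCompactSupport φ) :
    Tendsto (fun δ => ∫ p, φ p * Dl (regKernel δ) p) (𝓝[>] 0)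
      (𝓝 ((2 * Real.pi ^ 2) • φ 0)) := by
  have hlim : ∫ u : ℍ[ℝ], (4 * ((‖u‖ ^ 2 + 1) ^ 3)⁻¹) • φ 0 = (2 * Real.pi ^ 2) • φ 0 := by
    rw [integral_smul_const, integral_const_mul, integral_bump]
    congr 1
    ring
  obtain ⟨M, hM⟩ := hc.exists_bound_of_continuous hφ
  rw [← hlim]
  refine Tendsto.congr' (f₁ := fun δ : ℝ => ∫ u : ℍ[ℝ], (4 * ((‖u‖ ^ 2 + 1) ^ 3)⁻¹) • φ (δ • u))
    (by filter_upwards [self_mem_nhdsWithin] with δ hδ using (integral_mul_Dl_regKernel φ hδ).symm)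
    ?_
  refine tendsto_integral_filter_of_dominated_convergence
    (fun u => (4 * ((‖u‖ ^ 2 + 1) ^ 3)⁻¹) * M) (Eventually.of_forall fun δ => ?_)
    (Eventually.of_forall fun δ => Eventually.of_forall fun u => ?_)
    ((integrable_bump.const_mul 4).mul_const M) (Eventually.of_forall fun u => ?_)
  · have h : Continuous fun u : ℍ[ℝ] => (‖u‖ ^ 2 + 1) ^ 3 := by fun_prop
    have h' : Continuous fun u : ℍ[ℝ] => φ (δ • u) := by fun_prop
    exact ((h.measurable.inv.const_mul 4).smul h'.measurable).aestronglyMeasurable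
  · rw [norm_smul, Real.norm_of_nonneg (by positivity)]
    gcongr
    exact hM _
  · have h : Continuous fun δ : ℝ => φ (δ • u) := by fun_prop
    have h' := (h.tendsto 0).mono_left (nhdsWithin_le_nhds (s := Set.Ioi 0))
    rw [zero_smul] at h'
    exact h'.const_smul _

lemma integral_Dr_mul_regKernel {φ : ℍ[ℝ] → ℍ[ℝ]} (hφ : ContDiff ℝ 1 φ)
    (hc : HasCompactSupport φ) :
    ∫ p, Dr φ p * regKernel 0 p = -((2 * Real.pi ^ 2) • φ 0) := by
  refine tendsto_nhds_unique
    (tendsto_integral_mul_regKernel (continuous_Dr hφ) (hasCompactSupport_Dr hc))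
    ((tendsto_integral_mul_Dl_regKernel hφ.continuous hc).neg.congr' ?_)
  filter_upwards [self_mem_nhdsWithin] with δ hδ
  exact (integral_Dr_mul hφ hc (contDiff_regKernel hδ)).symm

/-- The Cauchy–Fueter representation of compactly supported functions. -/
lemma integral_Dr_mul_E {φ : ℍ[ℝ] → ℍ[ℝ]} (hφ : ContDiff ℝ 1 φ)
    (hc : HasCompactSupport φ) (q : ℍ[ℝ]) : ∫ p, Dr φ p * E q p = φ q := by
  have hD : ∀ p, Dr (fun x => φ (x + q)) p = Dr φ (p + q) := fun p => by
    simp only [Dr, fderiv_comp_add_right]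
  have h := integral_Dr_mul_regKernel (φ := fun x => φ (x + q))
    (hφ.comp (contDiff_id.add contDiff_const)) (hc.comp_homeomorph (Homeomorph.addRight q))
  rw [← integral_add_right_eq_self _ q]
  simp only [E_eq_regKernel, add_sub_cancel_right, mul_neg, mul_smul_comm, ← hD]
  rw [integral_neg, integral_smul, h, smul_neg, neg_neg, zero_add,
    inv_smul_smul₀ (by positivity)]

/-- The potential kernel is jointly integrable against a bounded density and a test function. -/
lemma integrable_prod_mul_E_mul {Ω : Set ℍ[ℝ]} (hΩb : Bornology.IsBounded Ω)
    (hΩ : MeasurableSet Ω) {h : ℍ[ℝ] → ℍ[ℝ]} (hh : IntegrableOn h Ω) {ψ : ℍ[ℝ] → ℍ[ℝ]}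
    (hψ : Continuous ψ) (hc : HasCompactSupport ψ) :
    Integrable (fun z : ℍ[ℝ] × ℍ[ℝ] => ψ z.1 * (E z.2 z.1 * h z.2))
      ((volume.restrict Ω).prod (volume.restrict Ω)) := by
  obtain ⟨M, hM⟩ := hc.exists_bound_of_continuous hψ
  obtain ⟨R, hR⟩ := hΩb.subset_closedBall 0
  have hK : Integrable ((closedBall 0 (2 * R)).indicator (regKernel 0)) :=
    (locallyIntegrable_regKernel_zero.integrableOn_isCompact
      (isCompact_closedBall 0 (2 * R))).integrable_indicator measurableSet_closedBall
  have hconv := (hh.integrable_indicator hΩ).convolution_integrand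
    (ContinuousLinearMap.mul ℝ ℍ[ℝ]).flip hK
  have hmul := (hconv.bdd_mul (c := M) (f := fun z : ℍ[ℝ] × ℍ[ℝ] => ψ z.1)
    (by fun_prop) (Eventually.of_forall fun z => hM z.1)).const_mul
      (((-(2 * Real.pi ^ 2)⁻¹ : ℝ)) : ℍ[ℝ])
  rw [Measure.prod_restrict]
  refine (hmul.integrableOn (s := Ω ×ˢ Ω)).congr_fun (fun z hz => ?_) (hΩ.prod hΩ)
  have h1 : z.1 - z.2 ∈ closedBall (0 : ℍ[ℝ]) (2 * R) := by
    have h1 := mem_closedBall_zero_iff.1 (hR hz.1)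
    have h2 := mem_closedBall_zero_iff.1 (hR hz.2)
    rw [mem_closedBall_zero_iff]
    linarith [norm_sub_le z.1 z.2]
  simp only [ContinuousLinearMap.flip_apply, ContinuousLinearMap.mul_apply',
    Set.indicator_of_mem hz.2, Set.indicator_of_mem h1, E_eq_regKernel, Quaternion.coe_mul_eq_smul]
  simp only [neg_mul, mul_neg, smul_mul_assoc, mul_smul_comm, neg_smul]

/-- **The Newton-type potential of `h` is a weak solution of `D_l g = h`.** -/
theorem potential_is_weak_solution (Ω : Set ℍ[ℝ]) (hΩ : IsOpen Ω)
    (hΩb : Bornology.IsBounded Ω) (h : ℍ[ℝ] → ℍ[ℝ])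
    (hmeas : AEStronglyMeasurable h (volume.restrict Ω))
    (hbd : ∃ C : ℝ, ∀ q ∈ Ω, ‖h q‖ ≤ C)
    (g : ℍ[ℝ] → ℍ[ℝ]) (hg : ∀ p, g p = -∫ q in Ω, E q p * h q) :
    ∀ φ : ℍ[ℝ] → ℍ[ℝ], IsTestFunction φ Ω →
      ∫ q in Ω, (Dr φ q * g q + φ q * h q) = 0 := by
  intro φ hφ
  have hφ1 : ContDiff ℝ 1 φ := hφ.smooth.of_le (by exact_mod_cast le_top)
  obtain ⟨C, hC⟩ := hbd
  have hh : IntegrableOn h Ω :=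
    have : IsFiniteMeasure (volume.restrict Ω) := ⟨by simpa using hΩb.measure_lt_top⟩
    Integrable.of_bound hmeas C ((ae_restrict_iff' hΩ.measurableSet).2 (Eventually.of_forall hC))
  obtain ⟨M, hM⟩ := hφ.compact_supp.exists_bound_of_continuous hφ1.continuous
  have hφh : IntegrableOn (fun q => φ q * h q) Ω :=
    hh.bdd_mul hφ1.continuous.aestronglyMeasurable (Eventually.of_forall hM)
  have hprod := integrable_prod_mul_E_mul hΩb hΩ.measurableSet hh (continuous_Dr hφ1)
    (hasCompactSupport_Dr hφ.compact_supp)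
  have hDg : ∀ p, Dr φ p * g p = -∫ q in Ω, Dr φ p * (E q p * h q) := fun p => by
    rw [hg, mul_neg]
    exact congrArg Neg.neg (integral_smul (Dr φ p) fun q => E q p * h q).symm
  have hinner : ∀ q, ∫ p in Ω, Dr φ p * (E q p * h q) = φ q * h q := fun q => by
    rw [setIntegral_eq_integral_of_forall_compl_eq_zero fun p hp => by
      rw [image_eq_zero_of_notMem_tsupport fun h' =>
        hp (hφ.supp_subset (tsupport_Dr_subset φ h')), zero_mul]]
    simp only [← mul_assoc]
    rw [integral_mul_const_of_integrable (integrable_mul_E (continuous_Dr hφ1)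
      (hasCompactSupport_Dr hφ.compact_supp) q), integral_Dr_mul_E hφ1 hφ.compact_supp]
  simp only [hDg]
  have hneg : ∫ p in Ω, -∫ q in Ω, Dr φ p * (E q p * h q) = -∫ q in Ω, φ q * h q := by
    rw [integral_neg, integral_integral_swap hprod]
    simp only [hinner]
  refine (integral_add hprod.integral_prod_left.neg hφh).trans ?_
  exact (congrArg (· + _) hneg).trans (neg_add_cancel _)
end
end

section
/- Cauchy representation theorem for F-regular functions (ball case): Let c ∈ ℍ, R > 0, and let f : ℍ → ℍ be continuously differentiable on a neighborhood of the closed ball of radius R centered at c with D_l f = 0 there. Then for every p in the open ball B(c,R), f(p) = R³·∫_{ω∈S³} E(c+Rω, p)·ω·f(c+Rω) dσ(ω), where the outward unit normal at the boundary point c + Rω is the unit quaternion ω. -/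
open MeasureTheory Metric Filter
open scoped Quaternion Topology

noncomputable section

instance isAddHaarMeasure_volume_quaternion : (volume : Measure ℍ[ℝ]).IsAddHaarMeasure :=
  inferInstanceAs (stdOrthonormalBasis ℝ ℍ[ℝ]).toBasis.addHaar.IsAddHaarMeasure

/-- The total mass of the unit sphere `S³` is `2π²`. -/
theorem toSphere_real_univ_quaternion :
    (volume : Measure ℍ[ℝ]).toSphere.real Set.univ = 2 * Real.pi ^ 2 := by
  have h4 : Module.finrank ℝ ℍ[ℝ] = 4 := Quaternion.finrank_eq_four
  have hv := @InnerProductSpace.volume_ball_of_dim_even ℍ[ℝ] _ _ _ _ _ _ 2 (by rw [h4]) 0 1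
  have hv' : (volume : Measure ℍ[ℝ]) (ball 0 1) = _ := hv
  rw [Measure.toSphere_real_apply_univ, h4, measureReal_def, hv']
  simp only [ENNReal.ofReal_one, one_pow, one_mul]
  rw [ENNReal.toReal_ofReal (by positivity)]
  norm_num [Nat.factorial]
  ring

section Polar

variable {X F : Type*} [NormedAddCommGroup X] [NormedSpace ℝ X] [FiniteDimensional ℝ X]
  [MeasurableSpace X] [BorelSpace X] [Nontrivial X] [NormedAddCommGroup F] [NormedSpace ℝ F]

/-- Integration against `volumeIoiPow`. -/
theorem integral_volumeIoiPow (n : ℕ) (g : ℝ → F) :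
    ∫ r : Set.Ioi (0 : ℝ), g r ∂Measure.volumeIoiPow n = ∫ r in Set.Ioi (0 : ℝ), r ^ n • g r := by
  simp only [Measure.volumeIoiPow, ENNReal.ofReal]
  rw [integral_withDensity_eq_integral_smul,
    integral_subtype_comap measurableSet_Ioi fun a ↦ Real.toNNReal (a ^ n) • g a,
    setIntegral_congr_fun measurableSet_Ioi fun x hx ↦ ?_]
  · rw [NNReal.smul_def, Real.coe_toNNReal _ (pow_nonneg hx.out.le _)]
  · exact (measurable_subtype_coe.pow_const _).real_toNNReal

/-- Integration in polar coordinates, for an integrable function. -/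
theorem integral_eq_integral_toSphere (μ : Measure X) [μ.IsAddHaarMeasure] {H : X → F}
    (hH : Integrable H μ) :
    Integrable (fun ω : sphere (0 : X) 1 ↦
      ∫ r in Set.Ioi (0 : ℝ), r ^ (Module.finrank ℝ X - 1) • H (r • (ω : X))) μ.toSphere ∧
    ∫ x, H x ∂μ = ∫ ω : sphere (0 : X) 1,
      (∫ r in Set.Ioi (0 : ℝ), r ^ (Module.finrank ℝ X - 1) • H (r • (ω : X))) ∂μ.toSphere := by
  have hmp := μ.measurePreserving_homeomorphUnitSphereProd
  have hemb := (homeomorphUnitSphereProd X).measurableEmbedding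
  set K : sphere (0 : X) 1 × Set.Ioi (0 : ℝ) → F := fun z ↦ H ((z.2 : ℝ) • (z.1 : X)) with hK
  have hKH : ∀ x : ({0}ᶜ : Set X), K (homeomorphUnitSphereProd X x) = H x := by
    intro x
    have hx : ‖(x : X)‖ ≠ 0 := norm_ne_zero_iff.2 x.2
    simp [hK, smul_smul, hx]
  have hint : Integrable K (μ.toSphere.prod (.volumeIoiPow (Module.finrank ℝ X - 1))) := by
    rw [← hmp.integrable_comp_emb hemb]
    have h1 : IntegrableOn H ({0}ᶜ : Set X) μ := hH.integrableOn
    rw [integrableOn_iff_comap_subtypeVal (by measurability)] at h1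
    exact h1.congr (.of_forall fun x ↦ (hKH x).symm)
  have hinner : ∀ ω : sphere (0 : X) 1,
      ∫ r, K (ω, r) ∂Measure.volumeIoiPow (Module.finrank ℝ X - 1) =
        ∫ r in Set.Ioi (0 : ℝ), r ^ (Module.finrank ℝ X - 1) • H (r • (ω : X)) :=
    fun ω ↦ integral_volumeIoiPow _ fun r ↦ H (r • (ω : X))
  simp only [← hinner]
  refine ⟨hint.integral_prod_left, ?_⟩
  rw [← integral_prod _ hint, ← hmp.integral_comp hemb]
  simp only [hKH]
  rw [integral_subtype_comap (measurableSet_singleton _).compl fun x ↦ H x,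
    restrict_compl_singleton]

end Polar

@[simp] theorem qI_re : qI.re = 0 := rfl
@[simp] theorem qI_imI : qI.imI = 1 := rfl
@[simp] theorem qI_imJ : qI.imJ = 0 := rfl
@[simp] theorem qI_imK : qI.imK = 0 := rfl
@[simp] theorem qJ_re : qJ.re = 0 := rfl
@[simp] theorem qJ_imI : qJ.imI = 0 := rfl
@[simp] theorem qJ_imJ : qJ.imJ = 1 := rfl
@[simp] theorem qJ_imK : qJ.imK = 0 := rfl
@[simp] theorem qK_re : qK.re = 0 := rfl
@[simp] theorem qK_imI : qK.imI = 0 := rfl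
@[simp] theorem qK_imJ : qK.imJ = 0 := rfl
@[simp] theorem qK_imK : qK.imK = 1 := rfl

instance starModule_real_quaternion : StarModule ℝ ℍ[ℝ] :=
  ⟨fun r a ↦ by ext <;> simp⟩

/-- The quaternionic gradient `∂ψ/∂t + i ∂ψ/∂x + j ∂ψ/∂y + k ∂ψ/∂z` of a real function. -/
def quatGrad (ψ : ℍ[ℝ] → ℝ) (q : ℍ[ℝ]) : ℍ[ℝ] :=
  fderiv ℝ ψ q 1 • (1 : ℍ[ℝ]) + fderiv ℝ ψ q qI • qI + fderiv ℝ ψ q qJ • qJ + fderiv ℝ ψ q qK • qK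

theorem inner_frame_sum (x : ℍ[ℝ]) :
    inner ℝ x 1 • (1 : ℍ[ℝ]) + inner ℝ x qI • qI + inner ℝ x qJ • qJ + inner ℝ x qK • qK = x := by
  ext <;> simp [Quaternion.inner_def]

theorem integral_fderiv_eq_zero {X F : Type*} [NormedAddCommGroup X] [NormedSpace ℝ X]
    [FiniteDimensional ℝ X] [MeasurableSpace X] [BorelSpace X] [NormedAddCommGroup F]
    [NormedSpace ℝ F] (μ : Measure X) [μ.IsAddHaarMeasure] {h : X → F} (hh : ContDiff ℝ 1 h)
    (hc : HasCompactSupport h) (v : X) : ∫ x, fderiv ℝ h x v ∂μ = 0 := by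
  have h0 := integral_smul_fderiv_eq_neg_fderiv_smul_of_integrable (μ := μ) (𝕜 := ℝ)
    (f := fun _ : X ↦ (1 : ℝ)) (g := h) (v := v) (by simp)
    (by
      simp only [one_smul]
      exact ((hh.continuous_fderiv one_ne_zero).clm_apply
        continuous_const).integrable_of_hasCompactSupport (hc.fderiv_apply ℝ v))
    (by simpa using hh.continuous.integrable_of_hasCompactSupport hc)
    (by fun_prop) (fun x _ ↦ hh.differentiable one_ne_zero x)
  simpa using h0

/-- Weak form of Cauchy's theorem: right-regular times left-regular is divergence free. -/
theorem integral_mul_quatGrad_mul_eq_zero {V : Set ℍ[ℝ]} (hV : IsOpen V) {A f : ℍ[ℝ] → ℍ[ℝ]}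
    (hA : ContDiffOn ℝ 1 A V) (hf : ContDiffOn ℝ 1 f V) (hDA : ∀ q ∈ V, Dr A q = 0)
    (hDf : ∀ q ∈ V, Dl f q = 0) {ψ : ℍ[ℝ] → ℝ} (hψ : ContDiff ℝ 1 ψ)
    (hc : HasCompactSupport ψ) (hs : tsupport ψ ⊆ V) :
    ∫ q, A q * quatGrad ψ q * f q = 0 := by
  have hzero : ∀ q ∉ V, ψ =ᶠ[𝓝 q] 0 := fun q hq ↦
    notMem_tsupport_iff_eventuallyEq.1 fun h ↦ hq (hs h)
  have hcd : ∀ e : ℍ[ℝ], ContDiff ℝ 1 fun q ↦ ψ q • (A q * e * f q) := by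
    intro e
    rw [contDiff_iff_contDiffAt]
    intro q
    by_cases hq : q ∈ V
    · have hAq := hA.contDiffAt (hV.mem_nhds hq)
      have hfq := hf.contDiffAt (hV.mem_nhds hq)
      exact hψ.contDiffAt.smul ((hAq.mul contDiffAt_const).mul hfq)
    · refine (contDiffAt_const (c := (0 : ℍ[ℝ]))).congr_of_eventuallyEq ?_
      filter_upwards [hzero q hq] with x hx
      simp [hx]
  have hcs : ∀ e : ℍ[ℝ], HasCompactSupport fun q ↦ ψ q • (A q * e * f q) := fun e ↦ hc.smul_right
  have hint : ∀ e v : ℍ[ℝ],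
      Integrable (fun q ↦ fderiv ℝ (fun q ↦ ψ q • (A q * e * f q)) q v) := fun e v ↦
    (((hcd e).continuous_fderiv one_ne_zero).clm_apply
        continuous_const).integrable_of_hasCompactSupport ((hcs e).fderiv_apply ℝ v)
  have hzero_int : ∀ e : ℍ[ℝ], ∫ q, fderiv ℝ (fun q ↦ ψ q • (A q * e * f q)) q e = 0 := fun e ↦
    integral_fderiv_eq_zero volume (hcd e) (hcs e) e
  have hsum : ∫ q, (fderiv ℝ (fun q ↦ ψ q • (A q * 1 * f q)) q 1 +
      fderiv ℝ (fun q ↦ ψ q • (A q * qI * f q)) q qI +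
      fderiv ℝ (fun q ↦ ψ q • (A q * qJ * f q)) q qJ +
      fderiv ℝ (fun q ↦ ψ q • (A q * qK * f q)) q qK) = 0 := by
    rw [integral_add, integral_add, integral_add (hint 1 1) (hint qI qI)]
    · simp only [hzero_int, add_zero]
    · exact (hint 1 1).add (hint qI qI)
    · exact hint qJ qJ
    · exact ((hint 1 1).add (hint qI qI)).add (hint qJ qJ)
    · exact hint qK qK
  rw [← hsum]
  refine integral_congr_ae (.of_forall fun q ↦ ?_)
  by_cases hq : q ∈ V
  · have hAq := (hA.contDiffAt (hV.mem_nhds hq)).differentiableAt one_ne_zero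
    have hfq := (hf.contDiffAt (hV.mem_nhds hq)).differentiableAt one_ne_zero
    have hd : ∀ e v : ℍ[ℝ], fderiv ℝ (fun q ↦ ψ q • (A q * e * f q)) q v =
        ψ q • (fderiv ℝ A q v * e * f q + A q * e * fderiv ℝ f q v) +
          fderiv ℝ ψ q v • (A q * e * f q) := by
      intro e v
      have h1 : HasFDerivAt (fun q ↦ ψ q • (A q * e * f q)) _ q := (hψ.differentiable one_ne_zero q).hasFDerivAt.smul
        ((hAq.hasFDerivAt.mul' (hasFDerivAt_const e q)).mul' hfq.hasFDerivAt)
      rw [h1.fderiv]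
      simp
      abel
    have h1 : fderiv ℝ A q 1 = -(fderiv ℝ A q qI * qI + fderiv ℝ A q qJ * qJ +
        fderiv ℝ A q qK * qK) := by
      have := hDA q hq
      unfold Dr at this
      rw [eq_neg_iff_add_eq_zero, ← this]; abel
    have h2 : fderiv ℝ f q 1 = -(qI * fderiv ℝ f q qI + qJ * fderiv ℝ f q qJ +
        qK * fderiv ℝ f q qK) := by
      have := hDf q hq
      unfold Dl at this
      rw [eq_neg_iff_add_eq_zero, ← this]; abel
    simp only [hd, quatGrad, h1, h2]
    simp only [mul_add, add_mul, mul_neg, neg_mul, smul_add, smul_neg, mul_one, mul_smul_comm,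
      smul_mul_assoc, mul_assoc]
    abel
  · have h1 : ∀ e : ℍ[ℝ], fderiv ℝ (fun q ↦ ψ q • (A q * e * f q)) q = 0 := by
      intro e
      have : (fun q ↦ ψ q • (A q * e * f q)) =ᶠ[𝓝 q] fun _ ↦ 0 := by
        filter_upwards [hzero q hq] with x hx
        simp [hx]
      rw [this.fderiv_eq]; simp
    have h2 : fderiv ℝ ψ q = 0 := by rw [(hzero q hq).fderiv_eq]; simp
    simp only [h1, h2, quatGrad]
    simp

theorem E_eq (q p : ℍ[ℝ]) :
    E q p = (2 * Real.pi ^ 2)⁻¹ • ((‖q - p‖ ^ 2) ^ 2)⁻¹ • star (q - p) := by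
  rw [E, Quaternion.inv_def, Quaternion.normSq_eq_norm_mul_self, smul_smul, smul_smul]
  congr 1
  rw [mul_assoc, ← mul_inv]
  ring_nf

theorem hasFDerivAt_E {q p : ℍ[ℝ]} (h : q ≠ p) :
    ∃ L : ℍ[ℝ] →L[ℝ] ℍ[ℝ], HasFDerivAt (fun q ↦ E q p) L q ∧ ∀ v, L v =
      (2 * Real.pi ^ 2)⁻¹ • (((‖q - p‖ ^ 2) ^ 2)⁻¹ • star v
        - (4 * inner ℝ (q - p) v * ((‖q - p‖ ^ 2) ^ 3)⁻¹) • star (q - p)) := by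
  have hn : ‖q - p‖ ^ 2 ≠ 0 := by simpa [sub_eq_zero] using h
  have hsub : HasFDerivAt (fun q : ℍ[ℝ] ↦ q - p) (ContinuousLinearMap.id ℝ ℍ[ℝ]) q :=
    (hasFDerivAt_id q).sub_const p
  have hstar : HasFDerivAt (fun q : ℍ[ℝ] ↦ star (q - p)) _ q :=
    ((starL' ℝ : ℍ[ℝ] ≃L[ℝ] ℍ[ℝ]).toContinuousLinearMap.hasFDerivAt).comp q hsub
  have hnorm := (hasDerivAt_inv (pow_ne_zero 2 hn)).comp_hasFDerivAt q (hsub.norm_sq.pow 2)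
  have := (hnorm.smul hstar).const_smul (2 * Real.pi ^ 2)⁻¹
  refine ⟨_, this.congr_of_eventuallyEq (.of_forall fun x ↦ E_eq x p), fun v ↦ ?_⟩
  clear this hnorm hstar hsub
  simp only [Function.comp_apply]
  generalize q - p = x at hn ⊢
  simp [smul_smul, sub_eq_add_neg]
  congr 2
  field_simp
  ring_nf

theorem Dr_E_eq_zero {q p : ℍ[ℝ]} (h : q ≠ p) : Dr (fun q ↦ E q p) q = 0 := by
  obtain ⟨L, hL, hLv⟩ := hasFDerivAt_E h
  have hn : ‖q - p‖ ^ 2 ≠ 0 := by simpa [sub_eq_zero] using h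
  have hN : ‖q - p‖ ^ 2 = (q - p).re ^ 2 + (q - p).imI ^ 2 + (q - p).imJ ^ 2 + (q - p).imK ^ 2 := by
    rw [sq, ← Quaternion.normSq_eq_norm_mul_self, Quaternion.normSq_def']
  unfold Dr
  simp only [hL.fderiv, hLv]
  generalize q - p = x at *
  generalize ‖x‖ ^ 2 = N at *
  ext <;> simp [Quaternion.inner_def] <;> field_simp <;> rw [hN] <;> ring

theorem contDiffOn_E (p : ℍ[ℝ]) : ContDiffOn ℝ 1 (fun q ↦ E q p) {p}ᶜ := by
  have : (fun q ↦ E q p) =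
      fun q ↦ (2 * Real.pi ^ 2)⁻¹ • ((‖q - p‖ ^ 2) ^ 2)⁻¹ • star (q - p) :=
    funext fun q ↦ E_eq q p
  rw [this]
  intro q hq
  have hn : (‖q - p‖ ^ 2) ^ 2 ≠ 0 := by simpa [sub_eq_zero] using hq
  have hsub : ContDiff ℝ 1 fun q : ℍ[ℝ] ↦ q - p := contDiff_id.sub contDiff_const
  have hstar : ContDiff ℝ 1 fun q : ℍ[ℝ] ↦ star (q - p) :=
    (starL' ℝ : ℍ[ℝ] ≃L[ℝ] ℍ[ℝ]).contDiff.comp hsub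
  exact (((((hsub.norm_sq ℝ).pow 2).contDiffAt.inv hn).smul
    hstar.contDiffAt).const_smul (2 * Real.pi ^ 2)⁻¹).contDiffWithinAt

theorem exists_contDiff_cutoff {a b : ℝ} (hab : a < b) :
    ∃ χ : ℝ → ℝ, ContDiff ℝ 1 χ ∧ Antitone χ ∧ (∀ s ≤ a, χ s = 1) ∧ ∀ s, b ≤ s → χ s = 0 := by
  have h : 0 < b - a := sub_pos.2 hab
  refine ⟨fun s ↦ 1 - Real.smoothTransition ((s - a) / (b - a)),
    contDiff_const.sub (Real.smoothTransition.contDiff.comp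
      ((contDiff_id.sub contDiff_const).div_const _)), fun s t hst ↦ ?_, fun s hs ↦ ?_,
    fun s hs ↦ ?_⟩
  · exact sub_le_sub_left (Real.smoothTransition.monotone (by gcongr)) 1
  · simp only [Real.smoothTransition.zero_of_nonpos
      (div_nonpos_of_nonpos_of_nonneg (sub_nonpos.2 hs) h.le), sub_zero]
  · simp only [Real.smoothTransition.one_of_one_le
      ((one_le_div h).2 (sub_le_sub_right hs a)), sub_self]

section Radial

variable {a b : ℝ} {χ : ℝ → ℝ}

theorem deriv_cutoff_eq_zero (hb : 0 ≤ b) (h1 : ∀ s ≤ a ^ 2, χ s = 1)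
    (h0 : ∀ s, b ^ 2 ≤ s → χ s = 0) {r : ℝ} (hr : 0 ≤ r) (h : r ∉ Set.Icc a b) :
    deriv χ (r ^ 2) = 0 := by
  rw [Set.mem_Icc, not_and_or, not_le, not_le] at h
  rcases h with h | h
  · have : χ =ᶠ[𝓝 (r ^ 2)] fun _ ↦ 1 := by
      filter_upwards [Iio_mem_nhds (show r ^ 2 < a ^ 2 by gcongr)] with s hs using h1 s hs.le
    rw [this.deriv_eq, deriv_const]
  · have : χ =ᶠ[𝓝 (r ^ 2)] fun _ ↦ 0 := by
      filter_upwards [Ioi_mem_nhds (show b ^ 2 < r ^ 2 by gcongr)] with s hs using h0 s hs.le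
    rw [this.deriv_eq, deriv_const]

theorem integral_deriv_cutoff (hχ : ContDiff ℝ 1 χ) (hanti : Antitone χ)
    (h1 : ∀ s ≤ a ^ 2, χ s = 1) (h0 : ∀ s, b ^ 2 ≤ s → χ s = 0) :
    IntegrableOn (fun r ↦ -(2 * deriv χ (r ^ 2)) * r) (Set.Ioi 0) ∧
      ∫ r in Set.Ioi (0 : ℝ), -(2 * deriv χ (r ^ 2)) * r = 1 := by
  have hd : ∀ r ∈ Set.Ici (0 : ℝ),
      HasDerivAt (fun r ↦ -χ (r ^ 2)) (-(2 * deriv χ (r ^ 2)) * r) r := by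
    intro r _
    have := ((hχ.differentiable one_ne_zero (r ^ 2)).hasDerivAt.comp r (hasDerivAt_pow 2 r)).neg
    refine this.congr_deriv ?_
    push_cast
    ring
  have hlim : Tendsto (fun r ↦ -χ (r ^ 2)) atTop (𝓝 0) := by
    refine tendsto_const_nhds.congr' ?_
    filter_upwards [(tendsto_pow_atTop two_ne_zero).eventually_ge_atTop (b ^ 2)] with r hr
    rw [h0 _ hr, neg_zero]
  have hnn : ∀ r ∈ Set.Ioi (0 : ℝ), 0 ≤ -(2 * deriv χ (r ^ 2)) * r := fun r hr ↦
    mul_nonneg (by linarith [hanti.deriv_nonpos (x := r ^ 2)]) (le_of_lt hr)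
  have hi := integrableOn_Ioi_deriv_of_nonneg' hd hnn hlim
  refine ⟨hi, ?_⟩
  rw [integral_Ioi_of_hasDerivAt_of_tendsto' hd hi hlim, h1 _ (by rw [zero_pow two_ne_zero]; positivity)]
  norm_num

/-- A smoothed spherical shell integral of `V` is close to the integral of `Z` over the sphere
as soon as `r² V (c + r ω)` is close to `Z ω` on the shell. -/
theorem norm_integral_shell_sub_le (ha : 0 < a) (hab : a < b) (hχ : ContDiff ℝ 1 χ)
    (hanti : Antitone χ) (h1 : ∀ s ≤ a ^ 2, χ s = 1) (h0 : ∀ s, b ^ 2 ≤ s → χ s = 0)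
    {c : ℍ[ℝ]} {V : ℍ[ℝ] → ℍ[ℝ]} (hV : ContinuousOn V {q | a ≤ ‖q - c‖ ∧ ‖q - c‖ ≤ b})
    {Z : sphere (0 : ℍ[ℝ]) 1 → ℍ[ℝ]} (hZ : Continuous Z) {ε : ℝ}
    (hVZ : ∀ ω : sphere (0 : ℍ[ℝ]) 1, ∀ r ∈ Set.Icc a b,
      ‖r ^ 2 • V (c + r • (ω : ℍ[ℝ])) - Z ω‖ ≤ ε) :
    Integrable (fun q ↦ (2 * deriv χ (‖q - c‖ ^ 2)) • V q) ∧
    ‖-(∫ q, (2 * deriv χ (‖q - c‖ ^ 2)) • V q) - ∫ ω, Z ω ∂(volume : Measure ℍ[ℝ]).toSphere‖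
      ≤ ε * (volume : Measure ℍ[ℝ]).toSphere.real Set.univ := by
  have hdc : Continuous (deriv χ) := hχ.continuous_deriv le_rfl
  have hsupp : ∀ r : ℝ, 0 ≤ r → r ∉ Set.Icc a b → deriv χ (r ^ 2) = 0 := fun r hr h ↦
    deriv_cutoff_eq_zero (ha.trans hab).le h1 h0 hr h
  obtain ⟨hβi, hβ⟩ := integral_deriv_cutoff hχ hanti h1 h0
  set β : ℝ → ℝ := fun r ↦ -(2 * deriv χ (r ^ 2)) * r with hβdef
  have hβ0 : ∀ r : ℝ, 0 ≤ r → 0 ≤ β r := fun r hr ↦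
    mul_nonneg (by linarith [hanti.deriv_nonpos (x := r ^ 2)]) hr
  have hint : Integrable (fun q ↦ (2 * deriv χ (‖q - c‖ ^ 2)) • V q) := by
    have hK : IsCompact {q : ℍ[ℝ] | a ≤ ‖q - c‖ ∧ ‖q - c‖ ≤ b} := by
      refine (isCompact_closedBall c b).of_isClosed_subset ?_ fun q hq ↦ ?_
      · have hn : Continuous fun q : ℍ[ℝ] ↦ ‖q - c‖ := by fun_prop
        exact (isClosed_le continuous_const hn).inter (isClosed_le hn continuous_const)
      · rw [mem_closedBall_iff_norm]; exact hq.2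
    rw [← integrableOn_iff_integrable_of_support_subset (s := {q | a ≤ ‖q - c‖ ∧ ‖q - c‖ ≤ b})]
    · have hd : Continuous fun q : ℍ[ℝ] ↦ 2 * deriv χ (‖q - c‖ ^ 2) := by fun_prop
      exact ContinuousOn.integrableOn_compact hK (hd.continuousOn.fun_smul hV)
    · intro q hq
      by_contra h
      exact hq (by simp [hsupp ‖q - c‖ (norm_nonneg _) h])
  refine ⟨hint, ?_⟩
  have hint' : Integrable fun x ↦ -((2 * deriv χ (‖x‖ ^ 2)) • V (c + x)) := by
    simpa using (hint.comp_add_left c).neg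
  obtain ⟨hpi, hp⟩ := integral_eq_integral_toSphere volume hint'
  have hL : -(∫ q, (2 * deriv χ (‖q - c‖ ^ 2)) • V q) =
      ∫ x, -((2 * deriv χ (‖x‖ ^ 2)) • V (c + x)) := by
    rw [integral_neg, ← integral_add_left_eq_self _ c]
    simp
  have hinner : ∀ ω : sphere (0 : ℍ[ℝ]) 1, ∀ r ∈ Set.Ioi (0 : ℝ),
      r ^ (Module.finrank ℝ ℍ[ℝ] - 1) • -((2 * deriv χ (‖r • (ω : ℍ[ℝ])‖ ^ 2)) •
        V (c + r • (ω : ℍ[ℝ]))) = β r • (r ^ 2 • V (c + r • (ω : ℍ[ℝ]))) := by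
    intro ω r hr
    have hn : ‖r • (ω : ℍ[ℝ])‖ = r := by
      rw [norm_smul, norm_eq_of_mem_sphere, mul_one, Real.norm_of_nonneg (le_of_lt hr)]
    rw [hn, Quaternion.finrank_eq_four, ← neg_smul, smul_smul, smul_smul]
    congr 1
    simp only [hβdef]
    ring
  have hWint : ∀ ω : sphere (0 : ℍ[ℝ]) 1,
      IntegrableOn (fun r ↦ β r • (r ^ 2 • V (c + r • (ω : ℍ[ℝ])))) (Set.Ioi 0) := by
    intro ω
    have hc : ContinuousOn (fun r : ℝ ↦ β r • (r ^ 2 • V (c + r • (ω : ℍ[ℝ])))) (Set.Icc a b) := by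
      have hβc : Continuous β := by fun_prop
      refine hβc.continuousOn.fun_smul ((continuous_pow 2).continuousOn.fun_smul ?_)
      refine hV.comp (by fun_prop) fun r hr ↦ ?_
      have : ‖r • (ω : ℍ[ℝ])‖ = r := by
        rw [norm_smul, norm_eq_of_mem_sphere, mul_one, Real.norm_of_nonneg (ha.le.trans hr.1)]
      simpa [this] using hr
    refine (hc.integrableOn_compact isCompact_Icc).of_forall_sdiff_eq_zero measurableSet_Ioi ?_
    intro r hr
    simp [hβdef, hsupp r (le_of_lt hr.1) hr.2]
  have hZint : Integrable Z (volume : Measure ℍ[ℝ]).toSphere :=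
    hZ.integrable_of_hasCompactSupport (HasCompactSupport.of_compactSpace Z)
  rw [hL, hp, ← integral_sub hpi hZint]
  refine (norm_integral_le_of_norm_le_const (.of_forall fun ω ↦ ?_))
  rw [setIntegral_congr_fun measurableSet_Ioi (hinner ω)]
  have hZω : Z ω = ∫ r in Set.Ioi (0 : ℝ), β r • Z ω := by
    rw [integral_smul_const, hβ, one_smul]
  have hdiff : (∫ r in Set.Ioi (0 : ℝ), β r • (r ^ 2 • V (c + r • (ω : ℍ[ℝ])))) - Z ω =
      ∫ r in Set.Ioi (0 : ℝ), β r • (r ^ 2 • V (c + r • (ω : ℍ[ℝ])) - Z ω) := by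
    conv_lhs => rw [hZω]
    rw [← integral_sub (hWint ω) (hβi.smul_const _)]
    simp only [smul_sub]
  rw [hdiff]
  calc _ ≤ ∫ r in Set.Ioi (0 : ℝ), β r * ε := by
        refine norm_integral_le_of_norm_le (hβi.mul_const ε) ?_
        refine (ae_restrict_mem measurableSet_Ioi).mono fun r hr ↦ ?_
        rw [norm_smul, Real.norm_of_nonneg (hβ0 r (le_of_lt hr))]
        by_cases h : r ∈ Set.Icc a b
        · exact mul_le_mul_of_nonneg_left (hVZ ω r h) (hβ0 r (le_of_lt hr))
        · simp [hβdef, hsupp r (le_of_lt hr) h]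
    _ = ε := by rw [integral_mul_const, hβ, one_mul]

end Radial

theorem hasFDerivAt_radial {χ : ℝ → ℝ} (hχ : ContDiff ℝ 1 χ) (c q : ℍ[ℝ]) :
    HasFDerivAt (fun q ↦ χ (‖q - c‖ ^ 2))
      ((2 * deriv χ (‖q - c‖ ^ 2)) • innerSL ℝ (q - c)) q := by
  have := (hχ.differentiable one_ne_zero (‖q - c‖ ^ 2)).hasDerivAt.comp_hasFDerivAt q
    ((hasFDerivAt_id q).sub_const c).norm_sq
  refine this.congr_fderiv ?_
  ext v
  simp
  ring

theorem quatGrad_radial_sub_radial {χ₁ χ₂ : ℝ → ℝ} (h₁ : ContDiff ℝ 1 χ₁) (h₂ : ContDiff ℝ 1 χ₂)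
    (c p q : ℍ[ℝ]) :
    quatGrad (fun q ↦ χ₁ (‖q - c‖ ^ 2) - χ₂ (‖q - p‖ ^ 2)) q =
      (2 * deriv χ₁ (‖q - c‖ ^ 2)) • (q - c) - (2 * deriv χ₂ (‖q - p‖ ^ 2)) • (q - p) := by
  have hd : HasFDerivAt (fun q ↦ χ₁ (‖q - c‖ ^ 2) - χ₂ (‖q - p‖ ^ 2)) _ q :=
    (hasFDerivAt_radial h₁ c q).sub (hasFDerivAt_radial h₂ p q)
  have hc := inner_frame_sum (q - c)
  have hp := inner_frame_sum (q - p)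
  rw [quatGrad, hd.fderiv]
  generalize deriv χ₁ (‖q - c‖ ^ 2) = s
  generalize deriv χ₂ (‖q - p‖ ^ 2) = t
  conv_rhs => rw [← hc, ← hp]
  simp only [sub_apply, smul_apply, innerSL_apply_apply]
  module

theorem E_mul_sub {q p : ℍ[ℝ]} (h : q ≠ p) :
    E q p * (q - p) = ((2 * Real.pi ^ 2)⁻¹ * (‖q - p‖ ^ 2)⁻¹) • (1 : ℍ[ℝ]) := by
  rw [E, smul_mul_assoc, inv_mul_cancel₀ (sub_ne_zero.2 h)]

/-- **Cauchy representation theorem for F-regular functions (ball case).**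
`f(p) = ∫_{∂B(c,R)} E(q,p)·n(q)·f(q) dS(q)` for `p ∈ B(c,R)`. -/
theorem cauchy_representation_F_regular (c : ℍ[ℝ]) (R : ℝ) (hR : 0 < R)
    (f : ℍ[ℝ] → ℍ[ℝ]) (U : Set ℍ[ℝ]) (hU : IsOpen U) (hUB : closedBall c R ⊆ U)
    (hf : ContDiffOn ℝ 1 f U) (hreg : ∀ q ∈ U, Dl f q = 0) :
    ∀ p ∈ ball c R,
      f p = R ^ 3 • (∫ ω : sphere (0 : ℍ[ℝ]) 1,
        E (c + R • (ω : ℍ[ℝ])) p * (ω : ℍ[ℝ]) * f (c + R • (ω : ℍ[ℝ]))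
          ∂(volume : Measure ℍ[ℝ]).toSphere) := by
  intro p hp
  have hpR : ‖p - c‖ < R := mem_ball_iff_norm.1 hp
  have hfc : ∀ q ∈ U, ContinuousAt f q := fun q hq ↦
    (hf.contDiffAt (hU.mem_nhds hq)).continuousAt
  have hEc : ∀ q ≠ p, ContinuousAt (fun q ↦ E q p) q := fun q hq ↦
    ((contDiffOn_E p).contDiffAt (isOpen_compl_singleton.mem_nhds hq)).continuousAt
  set V₁ : ℍ[ℝ] → ℍ[ℝ] := fun q ↦ E q p * (q - c) * f q with hV₁
  set V₂ : ℍ[ℝ] → ℍ[ℝ] := fun q ↦ E q p * (q - p) * f q with hV₂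
  have hV₁c : ∀ q ∈ U, q ≠ p → ContinuousAt V₁ q := fun q hq hqp ↦
    ((hEc q hqp).mul (by fun_prop)).mul (hfc q hq)
  have hV₂c : ∀ q ∈ U, q ≠ p → ContinuousAt V₂ q := fun q hq hqp ↦
    ((hEc q hqp).mul (by fun_prop)).mul (hfc q hq)
  have hnorm : ∀ (ω : sphere (0 : ℍ[ℝ]) 1) (r : ℝ), 0 ≤ r → ‖r • (ω : ℍ[ℝ])‖ = r := by
    intro ω r hr
    rw [norm_smul, norm_eq_of_mem_sphere, mul_one, Real.norm_of_nonneg hr]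
  have hSU : ∀ ω : sphere (0 : ℍ[ℝ]) 1, c + R • (ω : ℍ[ℝ]) ∈ U ∧ c + R • (ω : ℍ[ℝ]) ≠ p := by
    intro ω
    refine ⟨hUB ?_, fun h ↦ hpR.ne ?_⟩
    · rw [mem_closedBall_iff_norm, add_sub_cancel_left, hnorm ω R hR.le]
    · rw [← h, add_sub_cancel_left, hnorm ω R hR.le]
  have hcont : ∀ (ω : sphere (0 : ℍ[ℝ]) 1), ContinuousAt
      (fun z : ℝ × sphere (0 : ℍ[ℝ]) 1 ↦ z.1 ^ 2 • V₁ (c + z.1 • (z.2 : ℍ[ℝ]))) (R, ω) := by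
    intro ω
    refine (continuousAt_fst.pow 2).fun_smul ?_
    exact ContinuousAt.comp (f := fun z : ℝ × sphere (0 : ℍ[ℝ]) 1 ↦ c + z.1 • (z.2 : ℍ[ℝ]))
      (hV₁c _ (hSU ω).1 (hSU ω).2) (by fun_prop)
  set Z₁ : sphere (0 : ℍ[ℝ]) 1 → ℍ[ℝ] := fun ω ↦ R ^ 2 • V₁ (c + R • (ω : ℍ[ℝ])) with hZ₁
  have hZ₁c : Continuous Z₁ := continuous_iff_continuousAt.2 fun ω ↦
    ContinuousAt.comp (f := fun ω : sphere (0 : ℍ[ℝ]) 1 ↦ (R, ω)) (hcont ω) (by fun_prop)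
  have hI₁ : ∫ ω, Z₁ ω ∂(volume : Measure ℍ[ℝ]).toSphere =
      R ^ 3 • (∫ ω : sphere (0 : ℍ[ℝ]) 1,
        E (c + R • (ω : ℍ[ℝ])) p * (ω : ℍ[ℝ]) * f (c + R • (ω : ℍ[ℝ]))
          ∂(volume : Measure ℍ[ℝ]).toSphere) := by
    rw [← integral_smul]
    refine integral_congr_ae (.of_forall fun ω ↦ ?_)
    simp only [hZ₁, hV₁, add_sub_cancel_left, mul_smul_comm, smul_mul_assoc, smul_smul]
    congr 1
  have hI₂ : ∫ _ : sphere (0 : ℍ[ℝ]) 1, (2 * Real.pi ^ 2)⁻¹ • f p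
      ∂(volume : Measure ℍ[ℝ]).toSphere = f p := by
    rw [integral_const, toSphere_real_univ_quaternion, smul_smul,
      mul_inv_cancel₀ (by positivity), one_smul]
  rw [← hI₁, ← sub_eq_zero, ← norm_eq_zero]
  set M := (volume : Measure ℍ[ℝ]).toSphere.real Set.univ with hM
  have hM0 : 0 ≤ M := measureReal_nonneg
  suffices H : ∀ ε > 0, ‖f p - ∫ ω, Z₁ ω ∂(volume : Measure ℍ[ℝ]).toSphere‖ ≤ ε * M + ε * M by
    refine le_antisymm (le_of_forall_pos_le_add fun δ hδ ↦ ?_) (norm_nonneg _)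
    refine (H (δ / (2 * M + 1)) (by positivity)).trans ?_
    rw [zero_add, ← mul_add, ← two_mul, div_mul_eq_mul_div, div_le_iff₀ (by positivity)]
    nlinarith
  intro ε hε
  obtain ⟨a₁, ha₁p, ha₁R, hVZ₁⟩ : ∃ a, ‖p - c‖ < a ∧ a < R ∧
      ∀ ω : sphere (0 : ℍ[ℝ]) 1, ∀ r ∈ Set.Icc a R,
        ‖r ^ 2 • V₁ (c + r • (ω : ℍ[ℝ])) - Z₁ ω‖ ≤ ε := by
    have hev : ∀ᶠ r in 𝓝 R, ∀ ω ∈ (Set.univ : Set (sphere (0 : ℍ[ℝ]) 1)),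
        ‖r ^ 2 • V₁ (c + r • (ω : ℍ[ℝ])) - Z₁ ω‖ < ε := by
      refine isCompact_univ.eventually_forall_of_forall_eventually fun ω _ ↦ ?_
      have : ContinuousAt (fun z : ℝ × sphere (0 : ℍ[ℝ]) 1 ↦
          ‖z.1 ^ 2 • V₁ (c + z.1 • (z.2 : ℍ[ℝ])) - Z₁ z.2‖) (R, ω) :=
        ((hcont ω).sub (hZ₁c.continuousAt.comp continuousAt_snd)).norm
      exact this.eventually_lt_const (by simpa [hZ₁] using hε)
    obtain ⟨δ, hδ, hball⟩ := Metric.eventually_nhds_iff.1 hev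
    obtain ⟨a, ha, haR⟩ := exists_between (max_lt hpR (sub_lt_self R hδ))
    rw [max_lt_iff] at ha
    refine ⟨a, ha.1, haR, fun ω r hr ↦ (hball ?_ ω (Set.mem_univ _)).le⟩
    rw [Real.dist_eq, abs_lt]
    constructor <;> linarith [hr.1, hr.2]
  obtain ⟨b₂, hb₂, hb₂R, hfb₂⟩ : ∃ b, 0 < b ∧ closedBall p b ⊆ ball c R ∧
      ∀ q ∈ closedBall p b, ‖f q - f p‖ < ε * (2 * Real.pi ^ 2) := by
    have hev : ∀ᶠ q in 𝓝 p, q ∈ ball c R ∧ ‖f q - f p‖ < ε * (2 * Real.pi ^ 2) := by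
      refine (isOpen_ball.eventually_mem hp).and ?_
      have : ContinuousAt (fun q ↦ ‖f q - f p‖) p :=
        ((hfc p (hUB (ball_subset_closedBall hp))).sub continuousAt_const).norm
      exact this.eventually_lt_const (by simp only [sub_self, norm_zero]; positivity)
    obtain ⟨b, hb, hsub⟩ := Metric.nhds_basis_closedBall.eventually_iff.1 hev
    exact ⟨b, hb, fun q hq ↦ (hsub hq).1, fun q hq ↦ (hsub hq).2⟩
  obtain ⟨a₂, ha₂, ha₂b⟩ := exists_between hb₂
  have ha₁ : 0 < a₁ := (norm_nonneg _).trans_lt ha₁p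
  obtain ⟨χ₁, hχ₁, hanti₁, h1₁, h0₁⟩ := exists_contDiff_cutoff (show a₁ ^ 2 < R ^ 2 by gcongr)
  obtain ⟨χ₂, hχ₂, hanti₂, h1₂, h0₂⟩ := exists_contDiff_cutoff (show a₂ ^ 2 < b₂ ^ 2 by gcongr)
  have hVZ₂ : ∀ ω : sphere (0 : ℍ[ℝ]) 1, ∀ r ∈ Set.Icc a₂ b₂,
      ‖r ^ 2 • V₂ (p + r • (ω : ℍ[ℝ])) - (2 * Real.pi ^ 2)⁻¹ • f p‖ ≤ ε := by
    intro ω r hr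
    have hr0 : 0 < r := ha₂.trans_le hr.1
    have hn := hnorm ω r hr0.le
    have hne : p + r • (ω : ℍ[ℝ]) ≠ p := by
      rw [← sub_ne_zero, add_sub_cancel_left, ← norm_ne_zero_iff, hn]
      exact hr0.ne'
    have hmem : p + r • (ω : ℍ[ℝ]) ∈ closedBall p b₂ := by
      rw [mem_closedBall_iff_norm, add_sub_cancel_left, hn]
      exact hr.2
    have hpi : 0 < 2 * Real.pi ^ 2 := by positivity
    have hval : r ^ 2 • V₂ (p + r • (ω : ℍ[ℝ])) =
        (2 * Real.pi ^ 2)⁻¹ • f (p + r • (ω : ℍ[ℝ])) := by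
      simp only [hV₂]
      rw [E_mul_sub hne, add_sub_cancel_left, hn, smul_mul_assoc, one_mul, smul_smul]
      congr 1
      field_simp
    rw [hval, ← smul_sub, norm_smul, Real.norm_of_nonneg (by positivity),
      inv_mul_le_iff₀ hpi, mul_comm]
    exact (hfb₂ _ hmem).le
  have hV₁on : ContinuousOn V₁ {q | a₁ ≤ ‖q - c‖ ∧ ‖q - c‖ ≤ R} := fun q hq ↦
    (hV₁c q (hUB (mem_closedBall_iff_norm.2 hq.2)) fun h ↦
      ha₁p.not_ge (h ▸ hq.1)).continuousWithinAt
  have hV₂on : ContinuousOn V₂ {q | a₂ ≤ ‖q - p‖ ∧ ‖q - p‖ ≤ b₂} := fun q hq ↦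
    (hV₂c q (hUB (ball_subset_closedBall (hb₂R (mem_closedBall_iff_norm.2 hq.2)))) fun h ↦
      ha₂.not_ge (by simpa [h] using hq.1)).continuousWithinAt
  obtain ⟨hint₁, hle₁⟩ :=
    norm_integral_shell_sub_le ha₁ ha₁R hχ₁ hanti₁ h1₁ h0₁ hV₁on hZ₁c hVZ₁
  obtain ⟨hint₂, hle₂⟩ :=
    norm_integral_shell_sub_le ha₂ ha₂b hχ₂ hanti₂ h1₂ h0₂ hV₂on continuous_const hVZ₂
  rw [hI₂] at hle₂
  have hψ : ContDiff ℝ 1 fun q : ℍ[ℝ] ↦ χ₁ (‖q - c‖ ^ 2) - χ₂ (‖q - p‖ ^ 2) :=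
    (hχ₁.comp ((contDiff_id.sub contDiff_const).norm_sq ℝ)).sub
      (hχ₂.comp ((contDiff_id.sub contDiff_const).norm_sq ℝ))
  have hts : tsupport (fun q : ℍ[ℝ] ↦ χ₁ (‖q - c‖ ^ 2) - χ₂ (‖q - p‖ ^ 2)) ⊆
      closedBall c R \ (ball c a₁ ∩ ball p a₂) := by
    refine closure_minimal (fun q hq ↦ ⟨?_, fun h ↦ hq ?_⟩)
      (isClosed_closedBall.sdiff (isOpen_ball.inter isOpen_ball))
    · by_contra h
      have h₂ : q ∉ closedBall p b₂ := fun h' ↦ h (ball_subset_closedBall (hb₂R h'))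
      rw [mem_closedBall_iff_norm, not_le] at h h₂
      refine hq ?_
      simp only
      rw [h0₁ _ (by gcongr), h0₂ _ (by gcongr), sub_zero]
    · rw [Set.mem_inter_iff, mem_ball_iff_norm, mem_ball_iff_norm] at h
      simp only
      rw [h1₁ _ (by have := h.1; gcongr), h1₂ _ (by have := h.2; gcongr), sub_self]
  have hcs : HasCompactSupport fun q : ℍ[ℝ] ↦ χ₁ (‖q - c‖ ^ 2) - χ₂ (‖q - p‖ ^ 2) :=
    (isCompact_closedBall c R).of_isClosed_subset (isClosed_tsupport _)
      (hts.trans Set.sdiff_subset)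
  have hmain := integral_mul_quatGrad_mul_eq_zero (hU.inter isOpen_compl_singleton)
    ((contDiffOn_E p).mono Set.inter_subset_right) (hf.mono Set.inter_subset_left)
    (fun q hq ↦ Dr_E_eq_zero hq.2) (fun q hq ↦ hreg q hq.1) hψ hcs
    (hts.trans fun q hq ↦ ⟨hUB hq.1, fun h ↦ hq.2 (by
      rw [Set.mem_singleton_iff.1 h]
      exact ⟨mem_ball_iff_norm.2 ha₁p, mem_ball_self ha₂⟩)⟩)
  have heq : ∫ q, (2 * deriv χ₁ (‖q - c‖ ^ 2)) • V₁ q =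
      ∫ q, (2 * deriv χ₂ (‖q - p‖ ^ 2)) • V₂ q := by
    rw [← sub_eq_zero, ← integral_sub hint₁ hint₂, ← hmain]
    refine integral_congr_ae (.of_forall fun q ↦ ?_)
    simp only [quatGrad_radial_sub_radial hχ₁ hχ₂, hV₁, hV₂, mul_sub, sub_mul, mul_smul_comm,
      smul_mul_assoc]
  rw [heq] at hle₁
  rw [norm_sub_rev] at hle₂
  exact (norm_sub_le_norm_sub_add_norm_sub _ _ _).trans (add_le_add hle₂ hle₁)
end
end
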